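/- Let E ∈ ℝ. Then the matrix (A^E_N)^* A^E_N + (C^E_N)^* C^E_N is invertible and, as ε ↓ 0, ∫_{U(L)} Im( G^{E+iε}_N(0, Z(U)) ) dU converges to [ (A^E_N)^* A^E_N + (C^E_N)^* C^E_N ]^{-1}, where Im M = (M − M^*)/(2i), the integral is over the normalized Haar measure on U(L), the left boundary condition is Dirichlet Ẑ = 0 and the right boundary condition is Z(U) = −i(1+U)(1−U)^{-1} (defined for Haar-almost every U). -/

import Mathlib

open MeasureTheory Matrix
open scoped ComplexOrder

noncomputable section

/-- The space of complex `L × L` matrices. -/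
abbrev Mat (L : ℕ) := Matrix (Fin L) (Fin L) ℂ

/-- The `2L × 2L` transfer matrix `[[(z − V)T⁻¹, −T^*], [T⁻¹, 0]]`. -/
def transferM (L : ℕ) (z : ℂ) (T V : Mat L) : Matrix (Fin L ⊕ Fin L) (Fin L ⊕ Fin L) ℂ :=
  Matrix.fromBlocks ((z • (1 : Mat L) - V) * T⁻¹) (-(Tᴴ)) T⁻¹ 0

/-- The transfer matrix across the sample, `𝒯^z(N,0) = 𝒯_N^z ⋯ 𝒯_1^z`. -/
def transferProd (L N : ℕ) (T V : ℕ → Mat L) (z : ℂ) :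
    Matrix (Fin L ⊕ Fin L) (Fin L ⊕ Fin L) ℂ :=
  (((List.range N).map (fun n => transferM L z (T (n + 1)) (V (n + 1)))).reverse).prod

def blockA (L N : ℕ) (T V : ℕ → Mat L) (z : ℂ) : Mat L := (transferProd L N T V z).toBlocks₁₁
def blockB (L N : ℕ) (T V : ℕ → Mat L) (z : ℂ) : Mat L := (transferProd L N T V z).toBlocks₁₂
def blockC (L N : ℕ) (T V : ℕ → Mat L) (z : ℂ) : Mat L := (transferProd L N T V z).toBlocks₂₁
def blockD (L N : ℕ) (T V : ℕ → Mat L) (z : ℂ) : Mat L := (transferProd L N T V z).toBlocks₂₂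

/-- The block tridiagonal Jacobi matrix `H^N_{Ẑ,Z}` (sites `1,…,N` are indexed by `Fin N`). -/
def jacobi (L N : ℕ) (T V : ℕ → Mat L) (Zh Z : Mat L) :
    Matrix (Fin N × Fin L) (Fin N × Fin L) ℂ :=
  Matrix.of fun p q =>
    if p.1 = q.1 then
      (V (p.1.val + 1) - (if p.1.val = 0 then Zh else 0)
        - (if p.1.val = N - 1 then Z else 0)) p.2 q.2
    else if q.1.val = p.1.val + 1 then T (p.1.val + 2) p.2 q.2
    else if p.1.val = q.1.val + 1 then (T (q.1.val + 2))ᴴ p.2 q.2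
    else 0

/-- The Green matrix `G^z_N(Ẑ,Z) = π₁^* (H^N_{Ẑ,Z} − z)⁻¹ π₁`. -/
def green (L N : ℕ) (hN : 0 < N) (T V : ℕ → Mat L) (Zh Z : Mat L) (z : ℂ) : Mat L :=
  Matrix.of fun i j => (jacobi L N T V Zh Z - z • 1)⁻¹ (⟨0, hN⟩, i) (⟨0, hN⟩, j)

instance (L : ℕ) : MeasurableSpace (Matrix.unitaryGroup (Fin L) ℂ) := borel _

/-- The right boundary condition `Z(U) = −i(1+U)(1−U)⁻¹` associated with a unitary `U`. -/
def ZofU (L : ℕ) (U : Matrix.unitaryGroup (Fin L) ℂ) : Mat L :=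
  -(Complex.I • ((1 + (U : Mat L)) * (1 - (U : Mat L))⁻¹))

/-- The matrix imaginary part `Im M = (M − M^*)/(2i)`. -/
def matIm (L : ℕ) (M : Mat L) : Mat L := (2 * Complex.I)⁻¹ • (M - Mᴴ)

section TransferRecursion

variable {L N : ℕ} {T V : ℕ → Mat L} {z : ℂ}

lemma transferProd_succ (n : ℕ) :
    transferProd L (n + 1) T V z =
      transferM L z (T (n + 1)) (V (n + 1)) * transferProd L n T V z := by
  simp [transferProd, List.range_succ]

lemma transferProd_eq_fromBlocks (n : ℕ) :
    transferProd L n T V z =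
      fromBlocks (blockA L n T V z) (blockB L n T V z) (blockC L n T V z) (blockD L n T V z) :=
  (fromBlocks_toBlocks _).symm

lemma fromBlocks_block_succ (n : ℕ) :
    fromBlocks (blockA L (n + 1) T V z) (blockB L (n + 1) T V z)
        (blockC L (n + 1) T V z) (blockD L (n + 1) T V z) =
      fromBlocks
        ((z • (1 : Mat L) - V (n + 1)) * (T (n + 1))⁻¹ * blockA L n T V z
          - (T (n + 1))ᴴ * blockC L n T V z)
        ((z • (1 : Mat L) - V (n + 1)) * (T (n + 1))⁻¹ * blockB L n T V z
          - (T (n + 1))ᴴ * blockD L n T V z)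
        ((T (n + 1))⁻¹ * blockA L n T V z) ((T (n + 1))⁻¹ * blockB L n T V z) := by
  rw [← transferProd_eq_fromBlocks, transferProd_succ, transferProd_eq_fromBlocks n, transferM,
    fromBlocks_multiply]
  simp [sub_eq_add_neg]

lemma blockA_succ (n : ℕ) : blockA L (n + 1) T V z =
    (z • (1 : Mat L) - V (n + 1)) * (T (n + 1))⁻¹ * blockA L n T V z
      - (T (n + 1))ᴴ * blockC L n T V z :=
  (fromBlocks_inj.1 (fromBlocks_block_succ n)).1

lemma blockB_succ (n : ℕ) : blockB L (n + 1) T V z =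
    (z • (1 : Mat L) - V (n + 1)) * (T (n + 1))⁻¹ * blockB L n T V z
      - (T (n + 1))ᴴ * blockD L n T V z :=
  (fromBlocks_inj.1 (fromBlocks_block_succ n)).2.1

lemma blockC_succ (n : ℕ) : blockC L (n + 1) T V z = (T (n + 1))⁻¹ * blockA L n T V z :=
  (fromBlocks_inj.1 (fromBlocks_block_succ n)).2.2.1

lemma blockD_succ (n : ℕ) : blockD L (n + 1) T V z = (T (n + 1))⁻¹ * blockB L n T V z :=
  (fromBlocks_inj.1 (fromBlocks_block_succ n)).2.2.2

lemma blockA_zero : blockA L 0 T V z = 1 := by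
  ext i j; simp [blockA, transferProd, toBlocks₁₁, Matrix.one_apply]

lemma blockB_zero : blockB L 0 T V z = 0 := by
  ext i j; simp [blockB, transferProd, toBlocks₁₂]

lemma blockC_zero : blockC L 0 T V z = 0 := by
  ext i j; simp [blockC, transferProd, toBlocks₂₁]

lemma blockD_zero : blockD L 0 T V z = 1 := by
  ext i j; simp [blockD, transferProd, toBlocks₂₂, Matrix.one_apply]

/-- The skew form preserved by transfer matrices at real energies. -/
def symplecticJ (L : ℕ) : Matrix (Fin L ⊕ Fin L) (Fin L ⊕ Fin L) ℂ := fromBlocks 0 (-1) 1 0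

lemma transferM_conj_symplecticJ {E : ℝ} {T V : Mat L} (hT : IsUnit T) (hV : V.IsHermitian) :
    transferM L E T V * symplecticJ L * (transferM L E T V)ᴴ = symplecticJ L := by
  have hd : IsUnit T.det := (Matrix.isUnit_iff_isUnit_det T).1 hT
  have hd' : IsUnit Tᴴ.det := by rw [det_conjTranspose]; exact hd.star
  simp only [transferM, symplecticJ, fromBlocks_conjTranspose, fromBlocks_multiply, fromBlocks_inj,
    conjTranspose_mul, conjTranspose_sub, conjTranspose_smul, conjTranspose_one, hV.eq,
    conjTranspose_nonsing_inv, conjTranspose_neg, conjTranspose_conjTranspose, conjTranspose_zero]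
  have h1 : T * T⁻¹ = 1 := mul_nonsing_inv _ hd
  have h2 : T⁻¹ * T = 1 := nonsing_inv_mul _ hd
  have h3 : Tᴴ * Tᴴ⁻¹ = 1 := mul_nonsing_inv _ hd'
  have h4 : Tᴴ⁻¹ * Tᴴ = 1 := nonsing_inv_mul _ hd'
  simp [h2, h3, mul_assoc, ← mul_assoc Tᴴ]

lemma transferProd_conj_symplecticJ {E : ℝ} (hT : ∀ n, 1 ≤ n → n ≤ N → IsUnit (T n))
    (hV : ∀ n, 1 ≤ n → n ≤ N → (V n).IsHermitian) (n : ℕ) (hn : n ≤ N) :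
    transferProd L n T V E * symplecticJ L * (transferProd L n T V E)ᴴ = symplecticJ L := by
  induction n with
  | zero => simp [transferProd]
  | succ n ih =>
    have h := transferM_conj_symplecticJ (E := E) (hT (n + 1) (by omega) hn)
      (hV (n + 1) (by omega) hn)
    rw [transferProd_succ, conjTranspose_mul]
    calc _ = transferM L E (T (n + 1)) (V (n + 1)) * (transferProd L n T V E * symplecticJ L *
          (transferProd L n T V E)ᴴ) * (transferM L E (T (n + 1)) (V (n + 1)))ᴴ := by
            simp only [mul_assoc]
      _ = _ := by rw [ih (by omega), h]

/-- The relations between the blocks of a matrix preserving `symplecticJ`. -/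
lemma block_relations_of_conj_symplecticJ {A B C D : Mat L}
    (h : fromBlocks A B C D * symplecticJ L * (fromBlocks A B C D)ᴴ = symplecticJ L) :
    B * Aᴴ = A * Bᴴ ∧ D * Cᴴ = C * Dᴴ ∧ A * Dᴴ - B * Cᴴ = 1 ∧ D * Aᴴ - C * Bᴴ = 1 ∧
      Dᴴ * A - Bᴴ * C = 1 ∧ Aᴴ * C = Cᴴ * A := by
  have h' : (symplecticJ L * (fromBlocks A B C D)ᴴ * -symplecticJ L) * fromBlocks A B C D = 1 := by
    rw [mul_eq_one_comm]
    have hJ : symplecticJ L * -symplecticJ L = 1 := by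
      simp [symplecticJ, fromBlocks_multiply, fromBlocks_neg]
    rw [← mul_assoc, ← mul_assoc, h, hJ]
  simp only [symplecticJ, fromBlocks_conjTranspose, fromBlocks_multiply, fromBlocks_neg,
    ← fromBlocks_one, fromBlocks_inj] at h h'
  simp only [mul_zero, mul_one, zero_add, mul_neg, add_zero, neg_zero, zero_mul, neg_mul, one_mul,
    neg_neg] at h h'
  obtain ⟨h11, h12, h21, h22⟩ := h
  refine ⟨?_, ?_, ?_, ?_, ?_, ?_⟩
  · exact add_neg_eq_zero.1 h11
  · exact add_neg_eq_zero.1 h22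
  · rw [← neg_inj, ← h12]; abel
  · rw [← h21]; abel
  · rw [← h'.1]; abel
  · exact add_neg_eq_zero.1 (by rw [← h'.2.2.1]; abel)

lemma posDef_skewForm (hT1 : T 1 = 1) (hT : ∀ n, 1 ≤ n → n ≤ N → IsUnit (T n))
    (hV : ∀ n, 1 ≤ n → n ≤ N → (V n).IsHermitian) (hz : 0 < z.im) (n : ℕ) (hn1 : 1 ≤ n)
    (hn : n ≤ N) :
    (Complex.I • ((blockA L n T V z)ᴴ * blockC L n T V z
      - (blockC L n T V z)ᴴ * blockA L n T V z)).PosDef := by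
  have hz2 : (0 : ℂ) < ((2 * z.im : ℝ) : ℂ) := by
    exact_mod_cast (by positivity : 0 < 2 * z.im)
  have step : ∀ n, n + 1 ≤ N →
      Complex.I • ((blockA L (n + 1) T V z)ᴴ * blockC L (n + 1) T V z
        - (blockC L (n + 1) T V z)ᴴ * blockA L (n + 1) T V z)
      = Complex.I • ((blockA L n T V z)ᴴ * blockC L n T V z
          - (blockC L n T V z)ᴴ * blockA L n T V z)
        + ((2 * z.im : ℝ) : ℂ) • ((blockC L (n + 1) T V z)ᴴ * blockC L (n + 1) T V z) := by
    intro n hn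
    have hd : IsUnit (T (n + 1)).det :=
      (Matrix.isUnit_iff_isUnit_det _).1 (hT (n + 1) (by omega) hn)
    have hA : T (n + 1) * blockC L (n + 1) T V z = blockA L n T V z := by
      rw [blockC_succ, ← mul_assoc, mul_nonsing_inv _ hd, one_mul]
    have hA' : blockA L (n + 1) T V z = (z • (1 : Mat L) - V (n + 1)) * blockC L (n + 1) T V z
        - (T (n + 1))ᴴ * blockC L n T V z := by
      rw [blockA_succ, blockC_succ, mul_assoc]
    have hzz : ((2 * z.im : ℝ) : ℂ) = Complex.I * (star z - z) := by
      apply Complex.ext <;> simp; ring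
    rw [hA', ← hA, hzz]
    generalize blockC L (n + 1) T V z = c
    rw [mul_smul, ← smul_add]
    congr 1
    simp only [conjTranspose_sub, conjTranspose_mul, conjTranspose_smul,
      (hV (n + 1) (by omega) hn).eq, conjTranspose_conjTranspose, sub_mul, mul_sub, mul_assoc,
      smul_mul_assoc, one_mul, mul_smul_comm, sub_smul]
    abel
  induction n, hn1 using Nat.le_induction with
  | base =>
    rw [step 0 hn]
    simp only [blockA_zero, blockC_zero, blockC_succ, hT1]
    simpa using PosDef.one.smul hz2
  | succ n hn1 ih =>
    rw [step n hn]
    exact (ih (by omega)).add_posSemidef ((posSemidef_conjTranspose_mul_self _).smul hz2.le)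

end TransferRecursion

/-- A strict domination `KᴴK < PᴴP` makes `P - K` invertible. -/
lemma det_sub_ne_zero_of_posDef {n : Type*} [Fintype n] [DecidableEq n] {P K : Matrix n n ℂ}
    (h : (Pᴴ * P - Kᴴ * K).PosDef) : (P - K).det ≠ 0 := by
  intro hdet
  obtain ⟨x, hx, hPx⟩ := exists_mulVec_eq_zero_iff.2 hdet
  have hPK : P *ᵥ x = K *ᵥ x := by rwa [sub_mulVec, sub_eq_zero] at hPx
  have hpos := h.dotProduct_mulVec_pos hx
  rw [sub_mulVec, ← mulVec_mulVec, ← mulVec_mulVec, dotProduct_sub, dotProduct_mulVec _ Pᴴ,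
    dotProduct_mulVec _ Kᴴ, ← star_mulVec, ← star_mulVec, hPK, sub_self] at hpos
  exact hpos.false

lemma det_conjTranspose_mul_add_ne_zero {n : Type*} [Fintype n] [DecidableEq n]
    {A C X Y : Matrix n n ℂ} (h : X * A - Y * C = 1) : (Aᴴ * A + Cᴴ * C).det ≠ 0 := by
  intro hdet
  obtain ⟨x, hx, hMx⟩ := exists_mulVec_eq_zero_iff.2 hdet
  have h0 : star x ⬝ᵥ ((Aᴴ * A + Cᴴ * C) *ᵥ x) = 0 := by simp [hMx]
  rw [add_mulVec, ← mulVec_mulVec, ← mulVec_mulVec, dotProduct_add, dotProduct_mulVec _ Aᴴ,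
    dotProduct_mulVec _ Cᴴ, ← star_mulVec, ← star_mulVec] at h0
  obtain ⟨hA, hC⟩ := (add_eq_zero_iff_of_nonneg (dotProduct_star_self_nonneg _)
    (dotProduct_star_self_nonneg _)).1 h0
  rw [dotProduct_star_self_eq_zero] at hA hC
  apply hx
  rw [← one_mulVec x, ← h, sub_mulVec, ← mulVec_mulVec, ← mulVec_mulVec, hA, hC]
  simp

/-- A Hermitian matrix has no eigenvalue off the real axis. -/
lemma det_sub_smul_one_ne_zero {n : Type*} [Fintype n] [DecidableEq n] {H : Matrix n n ℂ}
    (hH : H.IsHermitian) {z : ℂ} (hz : z.im ≠ 0) : (H - z • (1 : Matrix n n ℂ)).det ≠ 0 := by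
  intro hdet
  obtain ⟨x, hx, hHx⟩ := exists_mulVec_eq_zero_iff.2 hdet
  have hHx' : H *ᵥ x = z • x := by
    rwa [sub_mulVec, smul_mulVec, one_mulVec, sub_eq_zero] at hHx
  have h1 : star x ⬝ᵥ (H *ᵥ x) = star z * (star x ⬝ᵥ x) := by
    rw [dotProduct_mulVec, ← hH.eq, ← star_mulVec, hHx']
    simp [smul_dotProduct]
  rw [hHx', dotProduct_smul, smul_eq_mul] at h1
  have hxx : star x ⬝ᵥ x ≠ 0 := fun h => hx (dotProduct_star_self_eq_zero.1 h)
  have := mul_right_cancel₀ hxx h1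
  exact hz (Complex.conj_eq_iff_im.1 this.symm)

section Green

variable {L N : ℕ} {T V : ℕ → Mat L}

/-- The `L × L` block of the Jacobi matrix at a pair of sites. -/
lemma jacobi_apply_eq_sum (Z : Mat L) (k m : Fin N) (i j : Fin L) :
    jacobi L N T V 0 Z (k, i) (m, j) =
      ((if m = k then V (k.val + 1) - (if k.val = N - 1 then Z else 0) else 0)
        + (if m.val = k.val + 1 then T (k.val + 2) else 0)
        + (if m.val + 1 = k.val then (T (k.val + 1))ᴴ else 0) : Mat L) i j := by
  rcases lt_trichotomy m.val k.val with h | h | h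
  · have h1 : k ≠ m := fun h' => by rw [h'] at h; omega
    have h2 : m.val ≠ k.val + 1 := by omega
    by_cases h3 : m.val + 1 = k.val
    · rw [← h3] at h2
      simp [jacobi, h1, h1.symm, h2, ← h3]
    · simp [jacobi, h1, h1.symm, h2, h3, Ne.symm h3]
  · have h1 : m = k := Fin.ext h
    simp [jacobi, h1]
  · have h1 : k ≠ m := fun h' => by rw [h'] at h; omega
    have h2 : m.val + 1 ≠ k.val := by omega
    by_cases h3 : m.val = k.val + 1
    · rw [h3] at h2
      simp [jacobi, h1, h1.symm, h3, h2]
    · simp [jacobi, h1, h1.symm, h2, h3, Ne.symm h2]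

lemma isHermitian_jacobi {Z : Mat L} (hV : ∀ n, 1 ≤ n → n ≤ N → (V n).IsHermitian)
    (hZ : Z.IsHermitian) : (jacobi L N T V 0 Z).IsHermitian := by
  ext ⟨k, i⟩ ⟨m, j⟩
  have hVk := (hV (k.val + 1) (by omega) (by omega)).apply i j
  rw [conjTranspose_apply]
  rcases lt_trichotomy m.val k.val with h | h | h
  · have h1 : k ≠ m := fun h' => by rw [h'] at h; omega
    have h2 : m.val ≠ k.val + 1 := by omega
    simp [jacobi, h1, h1.symm, h2]
    split_ifs <;> simp
  · obtain rfl : m = k := Fin.ext h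
    simp only [jacobi, of_apply, if_true, ite_self, sub_zero, Matrix.sub_apply, star_sub, hVk]
    split_ifs
    · rw [hZ.apply]
    · simp
  · have h1 : k ≠ m := fun h' => by rw [h'] at h; omega
    have h2 : k.val ≠ m.val + 1 := by omega
    simp [jacobi, h1, h1.symm, h2]
    split_ifs <;> simp

/-- The block of the resolvent at site `k + 1` and the first site, zero outside the sample. -/
def resolventColumn (L N : ℕ) (hN : 0 < N) (T V : ℕ → Mat L) (Z : Mat L) (z : ℂ) (k : ℕ) : Mat L :=
  of fun i j => if h : k < N then
    (jacobi L N T V 0 Z - z • (1 : Matrix (Fin N × Fin L) (Fin N × Fin L) ℂ))⁻¹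
      (⟨k, h⟩, i) (⟨0, hN⟩, j) else 0

lemma resolventColumn_zero (hN : 0 < N) (Z : Mat L) (z : ℂ) :
    resolventColumn L N hN T V Z z 0 = green L N hN T V 0 Z z := by
  ext i j
  simp [resolventColumn, green, hN]

/-- The block rows of the resolvent equation. -/
lemma resolventColumn_equation (hN : 0 < N) {Z : Mat L} {z : ℂ}
    (hdet : (jacobi L N T V 0 Z - z • (1 : Matrix (Fin N × Fin L) (Fin N × Fin L) ℂ)).det ≠ 0)
    (k : ℕ) (hk : k < N) :
    (V (k + 1) - (if k = N - 1 then Z else 0) - z • (1 : Mat L)) * resolventColumn L N hN T V Z z k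
      + T (k + 2) * resolventColumn L N hN T V Z z (k + 1)
      + (if k = 0 then 0 else (T (k + 1))ᴴ * resolventColumn L N hN T V Z z (k - 1))
      = if k = 0 then 1 else 0 := by
  set φ := resolventColumn L N hN T V Z z with hφ
  set K := jacobi L N T V 0 Z - z • (1 : Matrix (Fin N × Fin L) (Fin N × Fin L) ℂ) with hK
  have hφX : ∀ (m : Fin N) (l j : Fin L), K⁻¹ (m, l) (⟨0, hN⟩, j) = φ m.val l j := by
    intro m l j
    simp [hφ, resolventColumn, hK]
  have hφN : ∀ m, N ≤ m → φ m = 0 := by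
    intro m hm
    ext i j
    simp [hφ, resolventColumn, not_lt.2 hm]
  have hKK : K * K⁻¹ = 1 := mul_nonsing_inv _ (isUnit_iff_ne_zero.2 hdet)
  let B : Fin N → Mat L := fun m =>
    (if m = ⟨k, hk⟩ then V (k + 1) - (if k = N - 1 then Z else 0) - z • (1 : Mat L) else 0)
      + (if m.val = k + 1 then T (k + 2) else 0)
      + (if m.val + 1 = k then (T (k + 1))ᴴ else 0)
  have hKB : ∀ (m : Fin N) (i l : Fin L), K (⟨k, hk⟩, i) (m, l) = B m i l := by
    intro m i l
    simp only [hK, Matrix.sub_apply, jacobi_apply_eq_sum, Matrix.smul_apply, B]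
    by_cases hm : m = ⟨k, hk⟩
    · subst hm
      simp [Matrix.one_apply]
    · have : ((⟨k, hk⟩ : Fin N), i) ≠ (m, l) := fun h => hm (Prod.ext_iff.1 h).1.symm
      simp [Matrix.one_apply_ne this, hm]
  have hsum : ∑ m : Fin N, B m * φ m.val = if k = 0 then 1 else 0 := by
    ext i j
    have h := congrFun (congrFun hKK (⟨k, hk⟩, i)) (⟨0, hN⟩, j)
    rw [Matrix.mul_apply, Fintype.sum_prod_type] at h
    simp only [hKB, hφX] at h
    rw [Matrix.sum_apply]
    simp only [Matrix.mul_apply]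
    rw [h]
    by_cases hk0 : k = 0
    · subst hk0
      simp [Matrix.one_apply]
    · simp [hk0]
  rw [← hsum]
  simp only [B, add_mul, Finset.sum_add_distrib, ite_mul, zero_mul]
  congr 1
  · congr 1
    · simp
    · by_cases h : k + 1 < N
      · rw [Finset.sum_eq_single ⟨k + 1, h⟩]
        · simp
        · intro b _ hb
          rw [if_neg fun h' => hb (Fin.ext h')]
        · simp
      · rw [hφN _ (not_lt.1 h), mul_zero, Finset.sum_eq_zero]
        intro m _
        rw [if_neg (by omega)]
  · by_cases h : k = 0
    · simp [h]
    · rw [if_neg h, Finset.sum_eq_single ⟨k - 1, by omega⟩]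
      · rw [if_pos (by simp; omega)]
      · intro b _ hb
        rw [if_neg fun h' => hb (Fin.ext (by simp; omega))]
      · simp

/-- The linear fractional relation satisfied by the Green matrix. -/
lemma blocks_mul_green (hN : 0 < N) {Z : Mat L} {z : ℂ} (hT1 : T 1 = 1)
    (hT : ∀ n, 1 ≤ n → n ≤ N → IsUnit (T n))
    (hdet : (jacobi L N T V 0 Z - z • (1 : Matrix (Fin N × Fin L) (Fin N × Fin L) ℂ)).det ≠ 0) :
    (blockA L N T V z + Z * blockC L N T V z) * green L N hN T V 0 Z z
      = blockB L N T V z + Z * blockD L N T V z := by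
  rw [← resolventColumn_zero hN]
  have heq := resolventColumn_equation hN hdet
  set φ := resolventColumn L N hN T V Z z
  have hinv : ∀ n, n + 1 ≤ N → (T (n + 1))⁻¹ * T (n + 1) = 1 := fun n hn =>
    nonsing_inv_mul _ ((Matrix.isUnit_iff_isUnit_det _).1 (hT (n + 1) (by omega) hn))
  have step : ∀ n, n + 1 ≤ N → ∀ ψ : Mat L,
      blockA L n T V z * φ 0 - blockB L n T V z = T (n + 1) * φ n →
      blockC L n T V z * φ 0 - blockD L n T V z = ψ →
      blockA L (n + 1) T V z * φ 0 - blockB L (n + 1) T V z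
        = (z • (1 : Mat L) - V (n + 1)) * φ n - (T (n + 1))ᴴ * ψ ∧
      blockC L (n + 1) T V z * φ 0 - blockD L (n + 1) T V z = φ n := by
    intro n hn ψ h1 h2
    constructor
    · rw [blockA_succ, blockB_succ]
      calc _ = (z • (1 : Mat L) - V (n + 1)) * ((T (n + 1))⁻¹ *
            (blockA L n T V z * φ 0 - blockB L n T V z))
            - (T (n + 1))ᴴ * (blockC L n T V z * φ 0 - blockD L n T V z) := by noncomm_ring
        _ = _ := by rw [h1, h2, ← mul_assoc (T (n + 1))⁻¹, hinv n hn, one_mul]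
    · rw [blockC_succ, blockD_succ, mul_assoc, ← mul_sub, h1, ← mul_assoc, hinv n hn, one_mul]
  have row : ∀ n, n < N → (z • (1 : Mat L) - V (n + 1)) * φ n
      - (T (n + 1))ᴴ * (if n = 0 then -1 else φ (n - 1))
      = T (n + 2) * φ (n + 1) - (if n = N - 1 then Z else 0) * φ n := by
    intro n hn
    have h := heq n hn
    have e : T (n + 2) * φ (n + 1) - (if n = N - 1 then Z else 0) * φ n
        = ((V (n + 1) - (if n = N - 1 then Z else 0) - z • (1 : Mat L)) * φ n
            + T (n + 2) * φ (n + 1)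
            + (if n = 0 then 0 else (T (n + 1))ᴴ * φ (n - 1)))
          - (V (n + 1) - z • (1 : Mat L)) * φ n
          - (if n = 0 then 0 else (T (n + 1))ᴴ * φ (n - 1)) := by
      noncomm_ring
    rw [e, h]
    by_cases h0 : n = 0
    · subst h0
      simp only [if_true, zero_add, hT1, conjTranspose_one]
      noncomm_ring
    · simp only [h0, if_false]
      noncomm_ring
  have main : ∀ n, n + 1 ≤ N →
      blockA L n T V z * φ 0 - blockB L n T V z = T (n + 1) * φ n ∧
      blockC L n T V z * φ 0 - blockD L n T V z = if n = 0 then -1 else φ (n - 1) := by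
    intro n
    induction n with
    | zero =>
      intro _
      simp [blockA_zero, blockB_zero, blockC_zero, blockD_zero, hT1]
    | succ n ih =>
      intro hn
      obtain ⟨h1, h2⟩ := ih (by omega)
      obtain ⟨h3, h4⟩ := step n (by omega) _ h1 h2
      rw [h3, h4, row n (by omega), if_neg (by omega : n ≠ N - 1)]
      simp
  obtain ⟨M, rfl⟩ : ∃ M, N = M + 1 := ⟨N - 1, by omega⟩
  obtain ⟨h1, h2⟩ := main M le_rfl
  obtain ⟨h3, h4⟩ := step M le_rfl _ h1 h2
  have hφM : φ (M + 1) = 0 := by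
    ext i j
    simp [φ, resolventColumn]
  rw [row M (by omega), if_pos (by simp), hφM, mul_zero, zero_sub, ← h4] at h3
  rw [← sub_eq_zero]
  calc _ = (blockA L (M + 1) T V z * φ 0 - blockB L (M + 1) T V z)
        + Z * (blockC L (M + 1) T V z * φ 0 - blockD L (M + 1) T V z) := by noncomm_ring
    _ = 0 := by rw [h3]; noncomm_ring

end Green

section Cayley

variable {L : ℕ} {U : Matrix.unitaryGroup (Fin L) ℂ}

lemma one_sub_star_mul_ZofU (hU : (1 - (U : Mat L)).det ≠ 0) :
    (1 - (U : Mat L)ᴴ) * ZofU L U = Complex.I • (1 + (U : Mat L)ᴴ) := by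
  have h1 : (U : Mat L)ᴴ * (U : Mat L) = 1 := UnitaryGroup.star_mul_self U
  have h2 : (1 - (U : Mat L)) * (1 - (U : Mat L))⁻¹ = 1 :=
    mul_nonsing_inv _ (isUnit_iff_ne_zero.2 hU)
  have h3 : (1 - (U : Mat L)ᴴ) * (1 + (U : Mat L)) = -((1 + (U : Mat L)ᴴ) * (1 - (U : Mat L))) := by
    simp only [sub_mul, mul_add, add_mul, mul_sub, h1, one_mul, mul_one]
    abel
  rw [ZofU, mul_neg, mul_smul_comm, ← mul_assoc, h3, neg_mul, mul_assoc, h2, mul_one, smul_neg,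
    neg_neg]

lemma isHermitian_ZofU (hU : (1 - (U : Mat L)).det ≠ 0) : (ZofU L U).IsHermitian := by
  have hU' : (1 - (U : Mat L)ᴴ).det ≠ 0 := by
    have : 1 - (U : Mat L)ᴴ = (1 - (U : Mat L))ᴴ := by simp
    rw [this, det_conjTranspose]
    exact star_ne_zero.2 hU
  have h2 : (1 - (U : Mat L)ᴴ)⁻¹ * (1 - (U : Mat L)ᴴ) = 1 :=
    nonsing_inv_mul _ (isUnit_iff_ne_zero.2 hU')
  have h3 : ZofU L U = (1 - (U : Mat L)ᴴ)⁻¹ * (Complex.I • (1 + (U : Mat L)ᴴ)) := by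
    rw [← one_sub_star_mul_ZofU hU, ← mul_assoc, h2, one_mul]
  rw [Matrix.IsHermitian]
  nth_rw 2 [h3]
  simp [ZofU, conjTranspose_nonsing_inv, -smul_add]

end Cayley

section InverseRegularity

variable {n : Type*} [Fintype n] [DecidableEq n]

lemma ContinuousAt.matrix_inv_of_det_ne_zero {X : Type*} [TopologicalSpace X] {M : X → Matrix n n ℂ}
    {x : X} (hM : ContinuousAt M x) (h : (M x).det ≠ 0) : ContinuousAt (fun y => (M y)⁻¹) x := by
  simp only [Matrix.inv_def, Ring.inverse_eq_inv']
  have hdet : ContinuousAt (fun y => (M y).det) x :=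
    (continuous_id.matrix_det).continuousAt.comp hM
  have hadj : ContinuousAt (fun y => (M y).adjugate) x :=
    (continuous_id.matrix_adjugate).continuousAt.comp hM
  exact (hdet.inv₀ h).smul hadj

lemma Continuous.matrix_inv_of_det_ne_zero {X : Type*} [TopologicalSpace X] {M : X → Matrix n n ℂ}
    (hM : Continuous M) (h : ∀ x, (M x).det ≠ 0) : Continuous (fun y => (M y)⁻¹) :=
  continuous_iff_continuousAt.2 fun x => hM.continuousAt.matrix_inv_of_det_ne_zero (h x)

lemma DifferentiableAt.matrix_det {M : ℂ → Matrix n n ℂ} {w : ℂ}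
    (hM : ∀ i j, DifferentiableAt ℂ (fun w => M w i j) w) :
    DifferentiableAt ℂ (fun w => (M w).det) w := by
  simp only [Matrix.det_apply']
  fun_prop

lemma DifferentiableAt.matrix_inv_apply {M : ℂ → Matrix n n ℂ} {w : ℂ}
    (hM : ∀ i j, DifferentiableAt ℂ (fun w => M w i j) w) (h : (M w).det ≠ 0) (i j : n) :
    DifferentiableAt ℂ (fun w => (M w)⁻¹ i j) w := by
  simp only [Matrix.inv_def, Ring.inverse_eq_inv', Matrix.smul_apply, smul_eq_mul, adjugate_apply]
  refine ((DifferentiableAt.matrix_det hM).inv h).mul (DifferentiableAt.matrix_det fun k l => ?_)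
  by_cases hk : k = j
  · subst hk
    simp
  · simpa [updateRow_ne hk] using hM k l

end InverseRegularity

section UnitaryGroup

variable {L : ℕ}

instance : BorelSpace (Matrix.unitaryGroup (Fin L) ℂ) := ⟨rfl⟩

instance : CompactSpace (Matrix.unitaryGroup (Fin L) ℂ) := by
  have hK : IsCompact (Set.univ.pi fun _ : Fin L => Set.univ.pi fun _ : Fin L =>
      Metric.closedBall (0 : ℂ) 1) :=
    isCompact_univ_pi fun _ => isCompact_univ_pi fun _ => isCompact_closedBall _ _
  refine (isCompact_iff_compactSpace (s := {U : Mat L | U ∈ Matrix.unitaryGroup (Fin L) ℂ})).1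
    (hK.of_isClosed_subset ?_ ?_)
  · simp only [mem_unitaryGroup_iff]
    exact isClosed_eq (by fun_prop) continuous_const
  · intro U hU i _ j _
    simpa using entry_norm_bound_of_unitary hU i j

/-- A scalar of modulus one as a unitary matrix. -/
def scalarUnitary (L : ℕ) (w : ℂ) (hw : ‖w‖ = 1) : Matrix.unitaryGroup (Fin L) ℂ :=
  ⟨w • 1, by
    rw [mem_unitaryGroup_iff, star_smul, star_one, smul_mul_smul_comm, one_mul,
      Complex.star_def, Complex.mul_conj, Complex.normSq_eq_norm_sq, hw]
    simp⟩

lemma coe_scalarUnitary_mul (w : ℂ) (hw : ‖w‖ = 1) (U : Matrix.unitaryGroup (Fin L) ℂ) :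
    ((scalarUnitary L w hw * U : Matrix.unitaryGroup (Fin L) ℂ) : Mat L) = w • (U : Mat L) := by
  rw [Submonoid.coe_mul]
  simp [scalarUnitary]

/-- Haar-almost every unitary matrix does not have the eigenvalue one. -/
lemma ae_det_one_sub_ne_zero (μ : Measure (Matrix.unitaryGroup (Fin L) ℂ)) [μ.IsHaarMeasure] :
    ∀ᵐ U ∂μ, (1 - ((U : Matrix.unitaryGroup (Fin L) ℂ) : Mat L)).det ≠ 0 := by
  have hmeas : MeasurableSet {x : ℝ × Matrix.unitaryGroup (Fin L) ℂ |
      (circleMap 0 1 x.1 • (1 : Mat L) - (x.2 : Mat L)).det ≠ 0} := by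
    refine (isOpen_ne_fun ?_ continuous_const).measurableSet
    have := continuous_circleMap 0 1
    exact Continuous.matrix_det (by fun_prop)
  have hU : ∀ᵐ U ∂μ, ∀ᵐ θ : ℝ,
      (circleMap 0 1 θ • (1 : Mat L) - ((U : Matrix.unitaryGroup (Fin L) ℂ) : Mat L)).det ≠ 0 := by
    refine .of_forall fun U => ?_
    have hfin : {w : ℂ | (w • (1 : Mat L) - (U : Mat L)).det = 0}.Finite := by
      refine ((U : Mat L).charpoly.roots.toFinset.finite_toSet).subset fun w hw => ?_
      simp only [Finset.mem_coe, Multiset.mem_toFinset,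
        Polynomial.mem_roots (charpoly_monic (U : Mat L)).ne_zero, Polynomial.IsRoot.def,
        eval_charpoly]
      rw [← hw.out, scalar_apply, smul_one_eq_diagonal]
    simpa [ae_iff] using (hfin.countable.preimage_circleMap 0 one_ne_zero).measure_zero volume
  obtain ⟨θ, hθ⟩ := ((Measure.ae_ae_comm hmeas).2 hU).exists
  have hw : ‖circleMap 0 1 θ‖ = 1 := by simp
  have hw' : ‖(circleMap 0 1 θ)⁻¹‖ = 1 := by rw [norm_inv, hw, inv_one]
  have hw0 : circleMap 0 1 θ ≠ 0 := by rw [← norm_ne_zero_iff, hw]; exact one_ne_zero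
  rw [← eventually_mul_left_iff μ (scalarUnitary L _ hw')]
  filter_upwards [hθ] with U hU
  rw [coe_scalarUnitary_mul]
  have : 1 - (circleMap 0 1 θ)⁻¹ • (U : Mat L)
      = (circleMap 0 1 θ)⁻¹ • (circleMap 0 1 θ • (1 : Mat L) - (U : Mat L)) := by
    rw [smul_sub, smul_smul, inv_mul_cancel₀ hw0, one_smul]
  rw [this, det_smul]
  exact mul_ne_zero (pow_ne_zero _ (inv_ne_zero hw0)) hU

end UnitaryGroup

section HaarAverage

variable {L : ℕ} {P Q R S : Mat L}

lemma det_sub_smul_star_mul_ne_zero (h : (Pᴴ * P - Qᴴ * Q).PosDef) {w : ℂ} (hw : ‖w‖ ≤ 1)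
    (U : Matrix.unitaryGroup (Fin L) ℂ) : (P - (w • (U : Mat L)ᴴ) * Q).det ≠ 0 := by
  refine det_sub_ne_zero_of_posDef ?_
  have hU : (U : Mat L) * (U : Mat L)ᴴ = 1 := mem_unitaryGroup_iff.1 U.2
  have hw' : (0 : ℂ) ≤ ((1 - ‖w‖ ^ 2 : ℝ) : ℂ) := by
    exact_mod_cast sub_nonneg.2 (pow_le_one₀ (norm_nonneg w) hw)
  have hK : ((w • (U : Mat L)ᴴ) * Q)ᴴ * ((w • (U : Mat L)ᴴ) * Q)
      = ((‖w‖ ^ 2 : ℝ) : ℂ) • (Qᴴ * Q) := by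
    rw [conjTranspose_mul, conjTranspose_smul, conjTranspose_conjTranspose, mul_assoc,
      ← mul_assoc (star w • (U : Mat L)), smul_mul_smul_comm, hU, smul_mul_assoc, one_mul,
      mul_smul_comm, Complex.star_def, mul_comm, Complex.mul_conj, Complex.normSq_eq_norm_sq]
  have : Pᴴ * P - ((w • (U : Mat L)ᴴ) * Q)ᴴ * ((w • (U : Mat L)ᴴ) * Q)
      = (Pᴴ * P - Qᴴ * Q) + ((1 - ‖w‖ ^ 2 : ℝ) : ℂ) • (Qᴴ * Q) := by
    rw [hK, Complex.ofReal_sub, sub_smul, Complex.ofReal_one, one_smul]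
    abel
  rw [this]
  exact h.add_posSemidef ((posSemidef_conjTranspose_mul_self _).smul hw')

/-- The mean value property over the unitary group of a matrix linear fractional map. -/
lemma integral_linearFractional (μ : Measure (Matrix.unitaryGroup (Fin L) ℂ)) [μ.IsHaarMeasure]
    [IsProbabilityMeasure μ] (h : (Pᴴ * P - Qᴴ * Q).PosDef) (i j : Fin L) :
    Integrable (fun U : Matrix.unitaryGroup (Fin L) ℂ =>
        ((P - (U : Mat L)ᴴ * Q)⁻¹ * (R - (U : Mat L)ᴴ * S)) i j) μ ∧
      ∫ U, ((P - (U : Mat L)ᴴ * Q)⁻¹ * (R - (U : Mat L)ᴴ * S)) i j ∂μ = (P⁻¹ * R) i j := by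
  set g : Mat L → ℂ := fun W => ((P - W * Q)⁻¹ * (R - W * S)) i j with hg
  have hcont : Continuous fun x : ℝ × Matrix.unitaryGroup (Fin L) ℂ =>
      g (circleMap 0 1 x.1 • (x.2 : Mat L)ᴴ) := by
    have := continuous_circleMap 0 1
    have hM : Continuous fun x : ℝ × Matrix.unitaryGroup (Fin L) ℂ =>
        (P - (circleMap 0 1 x.1 • (x.2 : Mat L)ᴴ) * Q)⁻¹ :=
      Continuous.matrix_inv_of_det_ne_zero (by fun_prop)
        fun x => det_sub_smul_star_mul_ne_zero h (by simp) x.2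
    exact (hM.matrix_mul (by fun_prop)).matrix_elem i j
  have hcontU : Continuous fun U : Matrix.unitaryGroup (Fin L) ℂ => g (U : Mat L)ᴴ := by
    have : Continuous fun U : Matrix.unitaryGroup (Fin L) ℂ => ((0 : ℝ), U) := by fun_prop
    simpa [Function.comp_def, circleMap] using hcont.comp this
  have hrot : ∀ (θ : ℝ), ∃ c : Matrix.unitaryGroup (Fin L) ℂ,
      ∀ U : Matrix.unitaryGroup (Fin L) ℂ,
        circleMap 0 1 θ • (U : Mat L)ᴴ = ((c * U : Matrix.unitaryGroup (Fin L) ℂ) : Mat L)ᴴ := by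
    intro θ
    refine ⟨scalarUnitary L (star (circleMap 0 1 θ)) (by simp), fun U => ?_⟩
    rw [coe_scalarUnitary_mul, conjTranspose_smul, star_star]
  obtain ⟨C, hC⟩ : ∃ C, ∀ U : Matrix.unitaryGroup (Fin L) ℂ, ‖g (U : Mat L)ᴴ‖ ≤ C := by
    obtain ⟨C, hC⟩ := isCompact_univ.exists_bound_of_continuousOn hcontU.continuousOn
    exact ⟨C, fun U => hC U trivial⟩
  refine ⟨.of_bound hcontU.aestronglyMeasurable C (.of_forall hC), ?_⟩
  have : IsFiniteMeasure (volume.restrict (Set.uIoc 0 (2 * Real.pi))) :=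
    ⟨by simp [Set.uIoc]⟩
  have hint : Integrable (Function.uncurry fun (θ : ℝ) (U : Matrix.unitaryGroup (Fin L) ℂ) =>
      g (circleMap 0 1 θ • (U : Mat L)ᴴ)) ((volume.restrict (Set.uIoc 0 (2 * Real.pi))).prod μ) := by
    refine .of_bound hcont.aestronglyMeasurable C (.of_forall fun x => ?_)
    obtain ⟨c, hc⟩ := hrot x.1
    rw [Function.uncurry, hc]
    exact hC _
  have hrotint : ∀ θ : ℝ, ∫ U : Matrix.unitaryGroup (Fin L) ℂ,
      g (circleMap 0 1 θ • (U : Mat L)ᴴ) ∂μ = ∫ U, g (U : Mat L)ᴴ ∂μ := by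
    intro θ
    obtain ⟨c, hc⟩ := hrot θ
    simp only [hc]
    exact integral_mul_left_eq_self (fun U : Matrix.unitaryGroup (Fin L) ℂ => g (U : Mat L)ᴴ) c
  have hmean : ∀ U : Matrix.unitaryGroup (Fin L) ℂ,
      ∫ θ in (0 : ℝ)..2 * Real.pi, g (circleMap 0 1 θ • (U : Mat L)ᴴ)
        = (2 * Real.pi) • (P⁻¹ * R) i j := by
    intro U
    have hdiff : DifferentiableOn ℂ (fun w : ℂ => g (w • (U : Mat L)ᴴ))
        (Metric.closedBall 0 1) := by
      intro w hw
      have hlin : ∀ (X Y : Mat L) (k l : Fin L),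
          DifferentiableAt ℂ (fun w : ℂ => (X - (w • (U : Mat L)ᴴ) * Y) k l) w := by
        intro X Y k l
        simp only [Matrix.sub_apply, smul_mul_assoc, Matrix.smul_apply]
        fun_prop
      refine DifferentiableAt.differentiableWithinAt ?_
      simp only [hg, Matrix.mul_apply (M := (P - _ * Q)⁻¹)]
      refine DifferentiableAt.fun_sum fun k _ => DifferentiableAt.fun_mul ?_ (hlin R S k j)
      exact DifferentiableAt.matrix_inv_apply (hlin P Q)
        (det_sub_smul_star_mul_ne_zero h (by simpa using hw) U) i k
    have hdc : DiffContOnCl ℂ (fun w : ℂ => g (w • (U : Mat L)ᴴ)) (Metric.ball 0 |1|) := by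
      refine DifferentiableOn.diffContOnCl ?_
      rwa [abs_one, closure_ball _ one_ne_zero]
    have hav := hdc.circleAverage
    rw [Real.circleAverage_def, inv_smul_eq_iff₀ (by positivity)] at hav
    rw [hav]
    simp [hg]
  have hswap := intervalIntegral_integral_swap hint
  simp only [hrotint, hmean, intervalIntegral.integral_const, integral_const, probReal_univ,
    one_smul, sub_zero] at hswap
  exact smul_right_injective ℂ (by positivity : (2 * Real.pi) ≠ 0) hswap

end HaarAverage

section EnergyLimit

variable {L N : ℕ} {T V : ℕ → Mat L}

lemma continuous_transferProd (n : ℕ) : Continuous (transferProd L n T V) := by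
  induction n with
  | zero => exact continuous_const (y := (1 : Matrix (Fin L ⊕ Fin L) (Fin L ⊕ Fin L) ℂ))
  | succ n ih =>
    simp only [funext fun z => transferProd_succ (L := L) (T := T) (V := V) (z := z) n]
    refine Continuous.matrix_mul ?_ ih
    exact Continuous.matrix_fromBlocks (by fun_prop) continuous_const continuous_const
      continuous_const

/-- The Green matrix for a unitary boundary condition as a linear fractional map of `U^*`. -/
lemma green_ZofU_eq (hN : 0 < N) (hT1 : T 1 = 1) (hT : ∀ n, 1 ≤ n → n ≤ N → IsUnit (T n))
    (hV : ∀ n, 1 ≤ n → n ≤ N → (V n).IsHermitian) {z : ℂ} (hz : 0 < z.im)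
    {P Q R S : Mat L}
    (hP : P = blockA L N T V z + Complex.I • blockC L N T V z)
    (hQ : Q = blockA L N T V z - Complex.I • blockC L N T V z)
    (hR : R = blockB L N T V z + Complex.I • blockD L N T V z)
    (hS : S = blockB L N T V z - Complex.I • blockD L N T V z)
    (hpos : (Pᴴ * P - Qᴴ * Q).PosDef)
    {U : Matrix.unitaryGroup (Fin L) ℂ} (hU : (1 - (U : Mat L)).det ≠ 0) :
    green L N hN T V 0 (ZofU L U) z = (P - (U : Mat L)ᴴ * Q)⁻¹ * (R - (U : Mat L)ᴴ * S) := by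
  have hdet : (P - (U : Mat L)ᴴ * Q).det ≠ 0 := by
    simpa using det_sub_smul_star_mul_ne_zero hpos (w := 1) (by simp) U
  have hG := blocks_mul_green (Z := ZofU L U) hN hT1 hT
    (det_sub_smul_one_ne_zero (isHermitian_jacobi hV (isHermitian_ZofU hU)) hz.ne')
  have hZ := one_sub_star_mul_ZofU hU
  have key : ∀ X Y : Mat L, (1 - (U : Mat L)ᴴ) * (X + ZofU L U * Y)
      = (X + Complex.I • Y) - (U : Mat L)ᴴ * (X - Complex.I • Y) := by
    intro X Y
    rw [mul_add, ← mul_assoc, hZ]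
    simp only [sub_mul, add_mul, mul_sub, one_mul, smul_mul_assoc, mul_smul_comm, smul_add]
    abel
  have h : (P - (U : Mat L)ᴴ * Q) * green L N hN T V 0 (ZofU L U) z
      = R - (U : Mat L)ᴴ * S := by
    rw [hP, hQ, hR, hS, ← key, ← key, mul_assoc, hG]
  rw [← h, ← mul_assoc, nonsing_inv_mul _ (isUnit_iff_ne_zero.2 hdet), one_mul]

lemma integral_matIm_green (hN : 0 < N) (hT1 : T 1 = 1)
    (hT : ∀ n, 1 ≤ n → n ≤ N → IsUnit (T n))
    (hV : ∀ n, 1 ≤ n → n ≤ N → (V n).IsHermitian) {z : ℂ} (hz : 0 < z.im)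
    (μ : Measure (Matrix.unitaryGroup (Fin L) ℂ)) [μ.IsHaarMeasure] [IsProbabilityMeasure μ]
    (i j : Fin L) :
    ∫ U, matIm L (green L N hN T V 0 (ZofU L U) z) i j ∂μ
      = matIm L ((blockA L N T V z + Complex.I • blockC L N T V z)⁻¹
          * (blockB L N T V z + Complex.I • blockD L N T V z)) i j := by
  set P := blockA L N T V z + Complex.I • blockC L N T V z with hP
  set Q := blockA L N T V z - Complex.I • blockC L N T V z with hQ
  set R := blockB L N T V z + Complex.I • blockD L N T V z with hR
  set S := blockB L N T V z - Complex.I • blockD L N T V z with hS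
  have hpos : (Pᴴ * P - Qᴴ * Q).PosDef := by
    have h2 : (0 : ℂ) < 2 := by norm_num
    have h := (posDef_skewForm hT1 hT hV hz N hN le_rfl).smul h2
    convert h using 1
    simp only [hP, hQ, conjTranspose_add, conjTranspose_sub, conjTranspose_smul, Complex.star_def,
      Complex.conj_I, add_mul, mul_add, sub_mul, mul_sub, smul_mul_assoc, mul_smul_comm, smul_sub,
      two_smul, neg_smul, neg_mul, smul_neg, smul_add]
    abel
  have hG : ∀ᵐ U ∂μ, matIm L (green L N hN T V 0 (ZofU L U) z) i j
      = (2 * Complex.I)⁻¹ *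
        (((P - (U : Mat L)ᴴ * Q)⁻¹ * (R - (U : Mat L)ᴴ * S)) i j
          - star (((P - (U : Mat L)ᴴ * Q)⁻¹ * (R - (U : Mat L)ᴴ * S)) j i)) := by
    filter_upwards [ae_det_one_sub_ne_zero μ] with U hU
    rw [green_ZofU_eq hN hT1 hT hV hz hP hQ hR hS hpos hU]
    simp only [matIm, Matrix.smul_apply, Matrix.sub_apply, conjTranspose_apply, smul_eq_mul]
  obtain ⟨hint, hval⟩ := integral_linearFractional (R := R) (S := S) μ hpos i j
  obtain ⟨hint', hval'⟩ := integral_linearFractional (R := R) (S := S) μ hpos j i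
  have hint'' : Integrable (fun U : Matrix.unitaryGroup (Fin L) ℂ =>
      star (((P - (U : Mat L)ᴴ * Q)⁻¹ * (R - (U : Mat L)ᴴ * S)) j i)) μ :=
    (LinearIsometryEquiv.integrable_comp_iff Complex.conjLIE).2 hint'
  have hconj : ∫ U : Matrix.unitaryGroup (Fin L) ℂ,
      star (((P - (U : Mat L)ᴴ * Q)⁻¹ * (R - (U : Mat L)ᴴ * S)) j i) ∂μ
      = star ((P⁻¹ * R) j i) := by
    rw [← hval']
    exact integral_conj
  rw [integral_congr_ae hG, integral_const_mul, integral_sub hint hint'', hval, hconj]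
  simp only [matIm, Matrix.smul_apply, Matrix.sub_apply, conjTranspose_apply, smul_eq_mul]

lemma conjTranspose_mul_self_add_I_smul {A C : Mat L} (h : Aᴴ * C = Cᴴ * A) :
    (A + Complex.I • C)ᴴ * (A + Complex.I • C) = Aᴴ * A + Cᴴ * C := by
  simp only [conjTranspose_add, conjTranspose_smul, Complex.star_def, Complex.conj_I, add_mul,
    mul_add, smul_mul_assoc, mul_smul_comm, h, neg_smul, neg_mul, smul_neg, smul_smul,
    Complex.I_mul_I, one_smul, neg_neg, smul_add]
  abel

lemma matIm_eq_inv_of_relations {A B C D : Mat L} (h1 : B * Aᴴ = A * Bᴴ) (h2 : D * Cᴴ = C * Dᴴ)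
    (h3 : A * Dᴴ - B * Cᴴ = 1) (h4 : D * Aᴴ - C * Bᴴ = 1) (h5 : Aᴴ * C = Cᴴ * A)
    (hdet : (A + Complex.I • C).det ≠ 0) :
    matIm L ((A + Complex.I • C)⁻¹ * (B + Complex.I • D)) = (Aᴴ * A + Cᴴ * C)⁻¹ := by
  have hRP : (B + Complex.I • D) * (A + Complex.I • C)ᴴ - (A + Complex.I • C) * (B + Complex.I • D)ᴴ
      = (2 * Complex.I) • (1 : Mat L) := by
    have : (2 * Complex.I) • (1 : Mat L) =
        Complex.I • (A * Dᴴ - B * Cᴴ) + Complex.I • (D * Aᴴ - C * Bᴴ) := by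
      rw [h3, h4, ← add_smul, two_mul]
    rw [this]
    simp only [conjTranspose_add, conjTranspose_smul, Complex.star_def, Complex.conj_I, add_mul,
      mul_add, smul_mul_assoc, mul_smul_comm, neg_smul, mul_neg, smul_smul,
      Complex.I_mul_I, one_smul, smul_sub, smul_add, h1, h2]
    abel
  rw [← conjTranspose_mul_self_add_I_smul h5]
  set P := A + Complex.I • C
  set R := B + Complex.I • D
  have hdet' : Pᴴ.det ≠ 0 := by rw [det_conjTranspose]; exact star_ne_zero.2 hdet
  have e1 : P⁻¹ * P = 1 := nonsing_inv_mul _ (isUnit_iff_ne_zero.2 hdet)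
  have e2 : Pᴴ * Pᴴ⁻¹ = 1 := mul_nonsing_inv _ (isUnit_iff_ne_zero.2 hdet')
  have e3 : P⁻¹ * R - (P⁻¹ * R)ᴴ = P⁻¹ * (R * Pᴴ - P * Rᴴ) * Pᴴ⁻¹ := by
    rw [mul_sub, sub_mul, ← mul_assoc, ← mul_assoc, e1, one_mul, mul_assoc, e2, mul_one,
      conjTranspose_mul, conjTranspose_nonsing_inv]
  rw [matIm, e3, hRP, Matrix.mul_inv_rev]
  simp only [mul_smul_comm, smul_mul_assoc, mul_one, smul_smul]
  rw [inv_mul_cancel₀ (by simp), one_smul]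

end EnergyLimit

theorem stmt8 (L N : ℕ) (hL : 1 ≤ L) (hN : 1 ≤ N)
    (T V : ℕ → Mat L) (hT1 : T 1 = 1)
    (hTinv : ∀ n, 2 ≤ n → n ≤ N → IsUnit (T n))
    (hV : ∀ n, 1 ≤ n → n ≤ N → (V n).IsHermitian)
    (μ : Measure (Matrix.unitaryGroup (Fin L) ℂ))
    [μ.IsHaarMeasure] [IsProbabilityMeasure μ]
    (E : ℝ) :
    IsUnit ((blockA L N T V (E : ℂ))ᴴ * blockA L N T V (E : ℂ)
        + (blockC L N T V (E : ℂ))ᴴ * blockC L N T V (E : ℂ)) ∧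
    (∀ i j : Fin L,
      Filter.Tendsto
        (fun ε : ℝ =>
          ∫ U, matIm L (green L N hN T V 0 (ZofU L U) ((E : ℂ) + ε * Complex.I)) i j ∂μ)
        (nhdsWithin 0 (Set.Ioi 0))
        (nhds (((blockA L N T V (E : ℂ))ᴴ * blockA L N T V (E : ℂ)
          + (blockC L N T V (E : ℂ))ᴴ * blockC L N T V (E : ℂ))⁻¹ i j))) := by
  have hT : ∀ n, 1 ≤ n → n ≤ N → IsUnit (T n) := by
    intro n hn1 hn
    rcases hn1.eq_or_lt with rfl | h
    · rw [hT1]; exact isUnit_one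
    · exact hTinv n h hn
  have hJ := transferProd_conj_symplecticJ (E := E) hT hV N le_rfl
  rw [transferProd_eq_fromBlocks] at hJ
  obtain ⟨h1, h2, h3, h4, h5, h6⟩ := block_relations_of_conj_symplecticJ hJ
  have hM := det_conjTranspose_mul_add_ne_zero h5
  refine ⟨(Matrix.isUnit_iff_isUnit_det _).2 (isUnit_iff_ne_zero.2 hM), fun i j => ?_⟩
  have hdet : (blockA L N T V (E : ℂ) + Complex.I • blockC L N T V (E : ℂ)).det ≠ 0 := by
    intro h0
    rw [← conjTranspose_mul_self_add_I_smul h6, det_mul, h0, mul_zero] at hM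
    exact hM rfl
  rw [← matIm_eq_inv_of_relations h1 h2 h3 h4 h6 hdet]
  have hc := continuous_transferProd (L := L) (T := T) (V := V) N
  have hA : Continuous (blockA L N T V) := continuous_matrix fun _ _ => hc.matrix_elem _ _
  have hB : Continuous (blockB L N T V) := continuous_matrix fun _ _ => hc.matrix_elem _ _
  have hC : Continuous (blockC L N T V) := continuous_matrix fun _ _ => hc.matrix_elem _ _
  have hD : Continuous (blockD L N T V) := continuous_matrix fun _ _ => hc.matrix_elem _ _
  have hinv : ContinuousAt (fun z => (blockA L N T V z + Complex.I • blockC L N T V z)⁻¹) (E : ℂ) :=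
    ContinuousAt.matrix_inv_of_det_ne_zero (by fun_prop) hdet
  have hG : ContinuousAt (fun z => (blockA L N T V z + Complex.I • blockC L N T V z)⁻¹
      * (blockB L N T V z + Complex.I • blockD L N T V z)) (E : ℂ) :=
    hinv.mul (by fun_prop)
  have hIm : Continuous fun M : Mat L => matIm L M i j := by
    unfold matIm
    exact Continuous.matrix_elem (by fun_prop) i j
  have hε : Filter.Tendsto (fun ε : ℝ => (E : ℂ) + ε * Complex.I) (nhdsWithin 0 (Set.Ioi 0))
      (nhds (E : ℂ)) := by
    have : Continuous fun ε : ℝ => (E : ℂ) + ε * Complex.I := by fun_prop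
    simpa using (this.tendsto 0).mono_left nhdsWithin_le_nhds
  refine ((hIm.continuousAt.tendsto.comp (hG.tendsto.comp hε))).congr' ?_
  filter_upwards [self_mem_nhdsWithin] with ε hε
  exact (integral_matIm_green hN hT1 hT hV (by simpa using hε) μ i j).symm
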